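/- Fix κ ∈ (0,1) and λ = √(1−κ²). Let p_κ be the Weierstrass ℘-function with invariants g₂ = 4/3 − κ² and g₃ = 8/27 − κ²/3, with fundamental half-periods ω_κ (positive real) and ω_κ′ (−i·ω_κ′ > 0). If p_κ(ω_κ′) = −1/3, then ℘(z; ω_κ, ω_κ′/2) = −2·p_λ(√2·i·z). -/

import Mathlib

open Complex

/-- The Weierstrass ℘-function for the lattice generated by `2ω` and `2ω'`. -/
noncomputable def wp (ω ω' : ℂ) (z : ℂ) : ℂ :=
  1 / z ^ 2 + ∑' p : {p : ℤ × ℤ // p ≠ 0},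
    (1 / (z - (2 * (p.1.1 : ℂ) * ω + 2 * (p.1.2 : ℂ) * ω')) ^ 2
      - 1 / (2 * (p.1.1 : ℂ) * ω + 2 * (p.1.2 : ℂ) * ω') ^ 2)

/-- The quadrinvariant g₂ of the lattice generated by `2ω` and `2ω'`. -/
noncomputable def g2inv (ω ω' : ℂ) : ℂ :=
  60 * ∑' p : {p : ℤ × ℤ // p ≠ 0},
    1 / (2 * (p.1.1 : ℂ) * ω + 2 * (p.1.2 : ℂ) * ω') ^ 4

/-- The cubinvariant g₃ of the lattice generated by `2ω` and `2ω'`. -/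
noncomputable def g3inv (ω ω' : ℂ) : ℂ :=
  140 * ∑' p : {p : ℤ × ℤ // p ≠ 0},
    1 / (2 * (p.1.1 : ℂ) * ω + 2 * (p.1.2 : ℂ) * ω') ^ 6

namespace PeriodPair

open Topology Filter

theorem isPreconnected_compl_of_subset_countable {s : Set ℂ} (hs : s.Countable) :
    IsPreconnected sᶜ :=
  (hs.isConnected_compl_of_one_lt_rank (by simp [Complex.rank_real_complex])).isPreconnected

theorem countable_lattice (L : PeriodPair) : (L.lattice : Set ℂ).Countable := by
  have : Countable L.lattice := L.latticeEquivProd.toEquiv.countable_iff.mpr inferInstance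
  exact Set.countable_coe_iff.mp this

theorem eventually_notMem_lattice (L : PeriodPair) (x : ℂ) : ∀ᶠ z in 𝓝[≠] x, z ∉ L.lattice := by
  filter_upwards [self_mem_nhdsWithin, mem_nhdsWithin_of_mem_nhds
    (L.compl_lattice_sdiff_singleton_mem_nhds x)] with w hw hw'
  simp_all

theorem weierstrassPExcept_zero_eq (L : PeriodPair) (z : ℂ) :
    L.weierstrassP z = L.weierstrassPExcept 0 z + 1 / z ^ 2 := by
  simpa using (L.weierstrassPExcept_add 0 z).symm

theorem derivWeierstrassPExcept_zero_eq (L : PeriodPair) (z : ℂ) :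
    L.derivWeierstrassP z = L.derivWeierstrassPExcept 0 z - 2 / z ^ 3 := by
  simpa using (L.derivWeierstrassPExcept_sub 0 z).symm

/-- The derivative `℘'` does not vanish identically. -/
theorem exists_derivWeierstrassP_ne_zero (L : PeriodPair) :
    ∃ z ∉ L.lattice, L.derivWeierstrassP z ≠ 0 := by
  by_contra! h
  have h1 : Tendsto (fun z ↦ z ^ 3 * L.derivWeierstrassPExcept 0 z) (𝓝[≠] 0) (𝓝 0) := by
    have := (L.analyticAt_derivWeierstrassPExcept 0).continuousAt
    have h2 : ContinuousAt (fun z ↦ z ^ 3 * L.derivWeierstrassPExcept 0 z) 0 := by fun_prop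
    simpa [ContinuousAt] using h2.mono_left nhdsWithin_le_nhds
  have h2 : Tendsto (fun z ↦ z ^ 3 * L.derivWeierstrassPExcept 0 z) (𝓝[≠] 0) (𝓝 2) := by
    refine tendsto_const_nhds.congr' ?_
    filter_upwards [L.eventually_notMem_lattice 0, self_mem_nhdsWithin] with z hz hz0
    have h3 := h z hz
    have hz0 : z ≠ 0 := hz0
    rw [derivWeierstrassPExcept_zero_eq, sub_eq_zero] at h3
    rw [h3]
    field_simp
  simpa using tendsto_nhds_unique h1 h2

/-- The second order differential equation `℘'' = 6 ℘² - g₂ / 2`. -/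
theorem deriv_derivWeierstrassP (L : PeriodPair) {z : ℂ} (hz : z ∉ L.lattice) :
    deriv L.derivWeierstrassP z = 6 * L.weierstrassP z ^ 2 - L.g₂ / 2 := by
  have hP := L.analyticOnNhd_weierstrassP
  have hP' := L.analyticOnNhd_derivWeierstrassP
  have hopen : IsOpen (L.lattice : Set ℂ)ᶜ := L.isClosed_lattice.isOpen_compl
  have key : ∀ w ∈ (L.lattice : Set ℂ)ᶜ, L.derivWeierstrassP w *
      (deriv L.derivWeierstrassP w - (6 * L.weierstrassP w ^ 2 - L.g₂ / 2)) = 0 := by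
    intro w hw
    have h1 : HasDerivAt L.weierstrassP (L.derivWeierstrassP w) w := by
      rw [← L.deriv_weierstrassP]
      exact (hP w hw).differentiableAt.hasDerivAt
    have h2 : HasDerivAt L.derivWeierstrassP (deriv L.derivWeierstrassP w) w :=
      (hP' w hw).differentiableAt.hasDerivAt
    have h3 := h2.pow 2
    have h4 := (((h1.pow 3).const_mul 4).sub (h1.const_mul L.g₂)).sub_const L.g₃
    have h5 := (h3.congr_of_eventuallyEq (f₁ := fun z ↦
      4 * L.weierstrassP z ^ 3 - L.g₂ * L.weierstrassP z - L.g₃) ?_).unique h4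
    · simp only [Nat.cast_ofNat, Nat.add_one_sub_one, pow_one] at h5
      linear_combination h5 / 2
    · filter_upwards [hopen.mem_nhds hw] with y hy using (L.derivWeierstrassP_sq y hy).symm
  rcases hP'.eq_zero_or_eq_zero_of_mul_eq_zero
    (hP'.deriv.sub ((analyticOnNhd_const.mul (hP.pow 2)).sub analyticOnNhd_const)) key
    (isPreconnected_compl_of_subset_countable L.countable_lattice) with h | h
  · obtain ⟨w, hw, hw'⟩ := L.exists_derivWeierstrassP_ne_zero
    exact absurd (h w hw) hw'
  · exact sub_eq_zero.mp (h z hz)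

theorem sumInvPow_four (L : PeriodPair) {z : ℂ} (hz : z ∉ L.lattice) :
    L.sumInvPow z 4 = L.weierstrassP z ^ 2 - L.g₂ / 12 := by
  have h := L.iteratedDeriv_weierstrassPExcept_self z (n := 2)
  rw [L.weierstrassPExcept_of_notMem z hz, iteratedDeriv_succ, iteratedDeriv_one,
    L.deriv_weierstrassP, L.deriv_derivWeierstrassP hz] at h
  simp [Nat.factorial] at h
  linear_combination -h / 6

theorem sumInvPow_six (L : PeriodPair) {z : ℂ} (hz : z ∉ L.lattice) :
    L.sumInvPow z 6 = L.weierstrassP z ^ 3 - 3 / 20 * L.g₂ * L.weierstrassP z - L.g₃ / 10 := by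
  have hopen : IsOpen (L.lattice : Set ℂ)ᶜ := L.isClosed_lattice.isOpen_compl
  have h := L.iteratedDeriv_weierstrassPExcept_self z (n := 4)
  have e2 : ∀ w ∉ L.lattice, deriv (deriv L.derivWeierstrassP) w =
      12 * L.weierstrassP w * L.derivWeierstrassP w := by
    intro w hw
    have h1 : HasDerivAt L.weierstrassP (L.derivWeierstrassP w) w := by
      rw [← L.deriv_weierstrassP]
      exact (L.analyticOnNhd_weierstrassP w hw).differentiableAt.hasDerivAt
    have h4 := ((h1.pow 2).const_mul 6).sub_const (L.g₂ / 2)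
    rw [Filter.EventuallyEq.deriv_eq (f := fun z ↦ 6 * L.weierstrassP z ^ 2 - L.g₂ / 2)]
    · refine h4.deriv.trans ?_
      simp
      ring
    · filter_upwards [hopen.mem_nhds hw] with y hy using L.deriv_derivWeierstrassP hy
  have e3 : deriv (deriv (deriv L.derivWeierstrassP)) z =
      12 * L.derivWeierstrassP z ^ 2 +
        12 * L.weierstrassP z * (6 * L.weierstrassP z ^ 2 - L.g₂ / 2) := by
    have h1 : HasDerivAt L.weierstrassP (L.derivWeierstrassP z) z := by
      rw [← L.deriv_weierstrassP]
      exact (L.analyticOnNhd_weierstrassP z hz).differentiableAt.hasDerivAt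
    have h2 := (L.analyticOnNhd_derivWeierstrassP z hz).differentiableAt.hasDerivAt
    rw [L.deriv_derivWeierstrassP hz] at h2
    rw [Filter.EventuallyEq.deriv_eq
      (f := fun w ↦ 12 * L.weierstrassP w * L.derivWeierstrassP w)]
    · refine ((h1.const_mul 12).mul h2).deriv.trans ?_
      ring
    · filter_upwards [hopen.mem_nhds hz] with y hy using e2 y hy
  rw [L.weierstrassPExcept_of_notMem z hz, iteratedDeriv_succ, iteratedDeriv_succ,
    iteratedDeriv_succ, iteratedDeriv_one, L.deriv_weierstrassP, e3,
    L.derivWeierstrassP_sq z hz] at h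
  simp [Nat.factorial] at h
  linear_combination -h / 120

theorem eventually_deriv_sub_eq (L₁ L₂ : PeriodPair) (h₂ : L₁.g₂ = L₂.g₂) :
    ∀ᶠ z in 𝓝[≠] (0 : ℂ),
      z ^ 2 * deriv (deriv (fun w ↦ L₁.weierstrassPExcept 0 w - L₂.weierstrassPExcept 0 w)) z =
        6 * (z ^ 2 * (L₁.weierstrassPExcept 0 z + L₂.weierstrassPExcept 0 z) + 2) *
          (L₁.weierstrassPExcept 0 z - L₂.weierstrassPExcept 0 z) := by
  have hopen₁ : IsOpen (L₁.lattice : Set ℂ)ᶜ := L₁.isClosed_lattice.isOpen_compl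
  have hopen₂ : IsOpen (L₂.lattice : Set ℂ)ᶜ := L₂.isClosed_lattice.isOpen_compl
  filter_upwards [L₁.eventually_notMem_lattice 0, L₂.eventually_notMem_lattice 0,
    self_mem_nhdsWithin] with z hz₁ hz₂ hz
  have hz : z ≠ 0 := hz
  have e : (fun w ↦ L₁.weierstrassPExcept 0 w - L₂.weierstrassPExcept 0 w) =
      fun w ↦ L₁.weierstrassP w - L₂.weierstrassP w := by
    ext w
    simp [weierstrassPExcept_zero_eq]
  have e1 : deriv (fun w ↦ L₁.weierstrassP w - L₂.weierstrassP w) =ᶠ[𝓝 z]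
      fun w ↦ L₁.derivWeierstrassP w - L₂.derivWeierstrassP w := by
    filter_upwards [hopen₁.mem_nhds hz₁, hopen₂.mem_nhds hz₂] with w hw₁ hw₂
    rw [deriv_fun_sub (L₁.analyticOnNhd_weierstrassP w hw₁).differentiableAt
      (L₂.analyticOnNhd_weierstrassP w hw₂).differentiableAt, deriv_weierstrassP,
      deriv_weierstrassP]
  rw [e, e1.deriv_eq, deriv_fun_sub (L₁.analyticOnNhd_derivWeierstrassP z hz₁).differentiableAt
    (L₂.analyticOnNhd_derivWeierstrassP z hz₂).differentiableAt, deriv_derivWeierstrassP _ hz₁,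
    deriv_derivWeierstrassP _ hz₂, weierstrassPExcept_zero_eq, weierstrassPExcept_zero_eq, h₂]
  field_simp
  ring

/-- An analytic function `f` with a zero of order at least five at the origin satisfying
`z² f'' = c f`, where `c` is analytic with `c 0 = 12`, vanishes near the origin. -/
theorem eventually_eq_zero_of_sq_mul_deriv_deriv_eq {f c : ℂ → ℂ} (hf : AnalyticAt ℂ f 0)
    (hc : ContinuousAt c 0) (hc0 : c 0 = 12) (hord : 5 ≤ analyticOrderAt f 0)
    (h : ∀ᶠ z in 𝓝[≠] (0 : ℂ), z ^ 2 * deriv (deriv f) z = c z * f z) :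
    ∀ᶠ z in 𝓝 (0 : ℂ), f z = 0 := by
  rw [← analyticOrderAt_eq_top]
  by_contra htop
  obtain ⟨n, hn⟩ := ENat.ne_top_iff_exists.mp htop
  obtain ⟨u, hu, hu0, hfu⟩ := (hf.analyticOrderAt_eq_natCast (n := n)).mp hn.symm
  have hn5 : 5 ≤ n := by
    rw [← hn] at hord
    exact_mod_cast hord
  obtain ⟨m, rfl⟩ : ∃ m, n = m + 2 := ⟨n - 2, by lia⟩
  simp only [sub_zero, smul_eq_mul] at hfu
  have hu' := hu.deriv
  have hu'' := hu'.deriv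
  have d1 : deriv f =ᶠ[𝓝 0]
      fun z ↦ (m + 2) * z ^ (m + 1) * u z + z ^ (m + 2) * deriv u z := by
    filter_upwards [hfu.eventually_nhds, hu.eventually_analyticAt] with z hz huz
    rw [Filter.EventuallyEq.deriv_eq hz]
    refine ((hasDerivAt_pow (m + 2) z).mul huz.differentiableAt.hasDerivAt).deriv.trans ?_
    simp
  have d2 : ∀ᶠ z in 𝓝 (0 : ℂ), deriv (deriv f) z = (m + 2) * (m + 1) * z ^ m * u z +
      2 * (m + 2) * z ^ (m + 1) * deriv u z + z ^ (m + 2) * deriv (deriv u) z := by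
    filter_upwards [d1.eventually_nhds, hu.eventually_analyticAt] with z hz huz
    rw [Filter.EventuallyEq.deriv_eq hz]
    refine ((((hasDerivAt_pow (m + 1) z).const_mul ((m : ℂ) + 2)).mul
      huz.differentiableAt.hasDerivAt).add ((hasDerivAt_pow (m + 2) z).mul
        huz.deriv.differentiableAt.hasDerivAt)).deriv.trans ?_
    simp
    ring
  have hz : ∀ᶠ z in 𝓝[≠] (0 : ℂ), (m + 2) * (m + 1) * u z + 2 * (m + 2) * z * deriv u z +
      z ^ 2 * deriv (deriv u) z - c z * u z = 0 := by
    filter_upwards [h, d2.filter_mono nhdsWithin_le_nhds, hfu.filter_mono nhdsWithin_le_nhds,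
      self_mem_nhdsWithin] with z h1 h2 h3 h4
    have h4 : z ^ (m + 2) ≠ 0 := pow_ne_zero _ h4
    rw [h2, h3] at h1
    apply mul_left_cancel₀ h4
    linear_combination h1
  have hcont : ContinuousAt (fun z ↦ (m + 2) * (m + 1) * u z + 2 * (m + 2) * z * deriv u z +
      z ^ 2 * deriv (deriv u) z - c z * u z) 0 := by
    have := hu.continuousAt
    have := hu'.continuousAt
    have := hu''.continuousAt
    fun_prop
  have hlim := tendsto_nhds_unique (hcont.tendsto.mono_left nhdsWithin_le_nhds)
    (tendsto_const_nhds.congr' (EventuallyEq.symm hz))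
  have h0 : (((m : ℂ) + 2) * (m + 1) - 12) * u 0 = 0 := by
    rw [hc0] at hlim
    linear_combination hlim
  rcases mul_eq_zero.mp h0 with h0 | h0
  · have h1 : (m + 2) * (m + 1) = 12 := by
      have := sub_eq_zero.mp h0
      exact_mod_cast this
    nlinarith
  · exact hu0 h0

theorem eventually_weierstrassP_eq {L₁ L₂ : PeriodPair} (h₂ : L₁.g₂ = L₂.g₂)
    (h₃ : L₁.g₃ = L₂.g₃) : ∀ᶠ z in 𝓝 (0 : ℂ), L₁.weierstrassP z = L₂.weierstrassP z := by
  have a₁ := L₁.analyticAt_weierstrassPExcept 0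
  have a₂ := L₂.analyticAt_weierstrassPExcept 0
  have := a₁.continuousAt
  have := a₂.continuousAt
  have h4 : L₁.G 4 = L₂.G 4 := by simpa [g₂] using h₂
  have h6 : L₁.G 6 = L₂.G 6 := by simpa [g₃] using h₃
  have key := eventually_eq_zero_of_sq_mul_deriv_deriv_eq (a₁.fun_sub a₂)
    (c := fun z ↦ 6 * (z ^ 2 * (L₁.weierstrassPExcept 0 z + L₂.weierstrassPExcept 0 z) + 2))
    (by fun_prop) (by norm_num) ?_ (eventually_deriv_sub_eq L₁ L₂ h₂)
  · filter_upwards [key] with z hz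
    rw [weierstrassPExcept_zero_eq, weierstrassPExcept_zero_eq, sub_eq_zero.mp hz]
  · refine (natCast_le_analyticOrderAt_iff_iteratedDeriv_eq_zero (n := 5)
      (a₁.fun_sub a₂)).mpr fun i hi ↦ ?_
    rw [iteratedDeriv_fun_sub a₁.contDiffAt a₂.contDiffAt,
      iteratedDeriv_weierstrassPExcept_self, iteratedDeriv_weierstrassPExcept_self]
    interval_cases i <;> simp [h4, h6, G_eq_zero_of_odd _ 3 (by decide), G_eq_zero_of_odd _ 5 (by decide)]

theorem lattice_le_of_eqOn {L₁ L₂ : PeriodPair}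
    (h : ∀ z ∉ L₁.lattice, z ∉ L₂.lattice → L₁.weierstrassP z = L₂.weierstrassP z) :
    L₁.lattice ≤ L₂.lattice := by
  intro x hx
  by_contra hx₂
  have h1 : L₁.weierstrassP =ᶠ[𝓝[≠] x] L₂.weierstrassP := by
    filter_upwards [L₁.eventually_notMem_lattice x, L₂.eventually_notMem_lattice x]
      with z hz₁ hz₂ using h z hz₁ hz₂
  have h2 := meromorphicOrderAt_congr h1
  rw [L₁.order_weierstrassP x hx] at h2
  have h3 := (L₂.analyticOnNhd_weierstrassP x hx₂).meromorphicOrderAt_nonneg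
  rw [← h2] at h3
  exact absurd h3 (by decide)

/-- The Weierstrass function is determined by its invariants `g₂` and `g₃`. -/
theorem weierstrassP_eq_of_g₂_eq_of_g₃_eq {L₁ L₂ : PeriodPair} (h₂ : L₁.g₂ = L₂.g₂)
    (h₃ : L₁.g₃ = L₂.g₃) : L₁.weierstrassP = L₂.weierstrassP := by
  set U : Set ℂ := (L₁.lattice ∪ L₂.lattice : Set ℂ)ᶜ with hU
  have hU₁ : U ⊆ (L₁.lattice : Set ℂ)ᶜ := Set.compl_subset_compl.mpr Set.subset_union_left
  have hU₂ : U ⊆ (L₂.lattice : Set ℂ)ᶜ := Set.compl_subset_compl.mpr Set.subset_union_right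
  obtain ⟨z₀, hz₀, hz₁, hz₂⟩ := (((eventually_weierstrassP_eq h₂ h₃).eventually_nhds.filter_mono
    (nhdsWithin_le_nhds (s := {0}ᶜ))).and ((L₁.eventually_notMem_lattice 0).and
      (L₂.eventually_notMem_lattice 0))).exists
  have hUeq : Set.EqOn L₁.weierstrassP L₂.weierstrassP U :=
    (L₁.analyticOnNhd_weierstrassP.mono hU₁).eqOn_of_preconnected_of_eventuallyEq
      (L₂.analyticOnNhd_weierstrassP.mono hU₂)
      (isPreconnected_compl_of_subset_countable (L₁.countable_lattice.union L₂.countable_lattice))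
      (z₀ := z₀) (by simp [hU, hz₁, hz₂]) hz₀
  have hlat : L₁.lattice = L₂.lattice :=
    le_antisymm (lattice_le_of_eqOn fun z h h' ↦ hUeq (by simp [hU, h, h']))
      (lattice_le_of_eqOn fun z h h' ↦ (hUeq (by simp [hU, h, h'])).symm)
  ext z
  by_cases hz : z ∈ L₁.lattice
  · rw [L₁.weierstrassP_coe ⟨z, hz⟩, L₂.weierstrassP_coe ⟨z, hlat ▸ hz⟩]
  · exact hUeq (by simp [hU, hz, ← hlat])

/-- Lattice sums over `L'`, the disjoint union of `L` and its translate by `w`. -/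
theorem G_eq_add_sumInvPow {L L' : PeriodPair} {w : ℂ} (hw : w ∉ L.lattice)
    (h : ∀ z, z ∈ L'.lattice ↔ z ∈ L.lattice ∨ z + w ∈ L.lattice) {n : ℕ} (hn : 2 < n) :
    L'.G n = L.G n + L.sumInvPow w n := by
  set f : ℂ → ℂ := fun z ↦ (z ^ n)⁻¹
  have hinj : Function.Injective (fun l : L.lattice ↦ l.1 - w) :=
    fun a b hab ↦ Subtype.ext (sub_left_injective hab)
  have h1 : HasSum (fun z : (L.lattice : Set ℂ) ↦ f z) (L.G n) := by
    have h := L.hasSum_sumInvPow 0 hn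
    simp only [sub_zero, sumInvPow_zero] at h
    exact h
  have h2 : HasSum (fun z : ↥(Set.range fun l : L.lattice ↦ l.1 - w) ↦ f z) (L.sumInvPow w n) :=
    (hinj.hasSum_range_iff (f := f)).mpr (L.hasSum_sumInvPow w hn)
  have hdisj : Disjoint (L.lattice : Set ℂ) (Set.range (fun l : L.lattice ↦ l.1 - w)) := by
    rw [Set.disjoint_left]
    rintro _ ha ⟨l, rfl⟩
    exact hw (by simpa using sub_mem l.2 ha)
  have hunion : (L'.lattice : Set ℂ) =
      (L.lattice : Set ℂ) ∪ Set.range (fun l : L.lattice ↦ l.1 - w) := by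
    ext z
    simp only [SetLike.mem_coe, h, Set.mem_union, Set.mem_range, Subtype.exists]
    refine or_congr_right ⟨fun hz ↦ ⟨z + w, hz, by simp⟩, ?_⟩
    rintro ⟨l, hl, rfl⟩
    simpa using hl
  have h3 := HasSum.add_disjoint (f := f) hdisj h1 h2
  rw [← hunion] at h3
  exact h3.tsum_eq

/-- The quadratic transformation of `g₂`. -/
theorem g₂_eq_of_index_two {L L' : PeriodPair} {w : ℂ} (hw : w ∉ L.lattice)
    (h : ∀ z, z ∈ L'.lattice ↔ z ∈ L.lattice ∨ z + w ∈ L.lattice) :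
    L'.g₂ = 60 * L.weierstrassP w ^ 2 - 4 * L.g₂ := by
  rw [g₂, G_eq_add_sumInvPow hw h (by norm_num), sumInvPow_four _ hw, g₂]
  ring

/-- The derivative of `℘` vanishes at half-periods. -/
theorem derivWeierstrassP_eq_zero_of_two_mul_mem (L : PeriodPair) {w : ℂ}
    (hw : 2 * w ∈ L.lattice) : L.derivWeierstrassP w = 0 := by
  have h := L.derivWeierstrassP_sub_coe w ⟨2 * w, hw⟩
  rw [show w - 2 * w = -w by ring, derivWeierstrassP_neg] at h
  exact CharZero.eq_neg_self_iff.mp h.symm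

/-- The quadratic transformation of `g₃`. -/
theorem g₃_eq_of_index_two {L L' : PeriodPair} {w : ℂ} (hw : w ∉ L.lattice)
    (hw₂ : 2 * w ∈ L.lattice)
    (h : ∀ z, z ∈ L'.lattice ↔ z ∈ L.lattice ∨ z + w ∈ L.lattice) :
    L'.g₃ = 56 * L.weierstrassP w ^ 3 + 8 * L.g₃ := by
  have h0 := L.derivWeierstrassP_sq w hw
  rw [L.derivWeierstrassP_eq_zero_of_two_mul_mem hw₂] at h0
  have h3 : L.g₃ = 140 * L.G 6 := rfl
  rw [g₃, G_eq_add_sumInvPow hw h (by norm_num), sumInvPow_six _ hw]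
  linear_combination -21 * h0 - h3

/-- The period pair with periods `2ω` and `2ω'`. -/
def ofHalfPeriods (ω ω' : ℂ) (h : LinearIndependent ℝ ![2 * ω, 2 * ω']) : PeriodPair :=
  ⟨2 * ω, 2 * ω', h⟩

variable {ω ω' : ℂ} (h : LinearIndependent ℝ ![2 * ω, 2 * ω'])

theorem ofHalfPeriods_latticeEquivProd_symm (p : ℤ × ℤ) :
    (((ofHalfPeriods ω ω' h).latticeEquivProd.symm p : (ofHalfPeriods ω ω' h).lattice) : ℂ) =
      2 * (p.1 : ℂ) * ω + 2 * (p.2 : ℂ) * ω' := by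
  rw [latticeEquiv_symm_apply]
  simp only [ofHalfPeriods]
  ring

theorem mem_lattice_ofHalfPeriods {z : ℂ} :
    z ∈ (ofHalfPeriods ω ω' h).lattice ↔
      ∃ m n : ℤ, 2 * (m : ℂ) * ω + 2 * (n : ℂ) * ω' = z := by
  rw [mem_lattice]
  refine exists_congr fun m ↦ exists_congr fun n ↦ ?_
  simp only [ofHalfPeriods]
  rw [show (m : ℂ) * (2 * ω) + n * (2 * ω') = 2 * m * ω + 2 * n * ω' by ring]

theorem wp_eq_weierstrassP (z : ℂ) : wp ω ω' z = (ofHalfPeriods ω ω' h).weierstrassP z := by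
  have hs := (Equiv.hasSum_iff (ofHalfPeriods ω ω' h).latticeEquivProd.symm.toEquiv).mpr
    ((ofHalfPeriods ω ω' h).hasSum_weierstrassP z)
  have h1 := hs.summable.sum_add_tsum_subtype_compl {(0 : ℤ × ℤ)}
  rw [hs.tsum_eq] at h1
  rw [← h1, wp]
  congr 1
  · simp
  · simp only [Function.comp_apply, LinearEquiv.coe_toEquiv,
      ofHalfPeriods_latticeEquivProd_symm]
    exact (Equiv.subtypeEquivRight (by simp)).tsum_eq (fun p : {p : ℤ × ℤ // p ∉ {(0 : ℤ × ℤ)}} ↦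
      1 / (z - (2 * (p.1.1 : ℂ) * ω + 2 * (p.1.2 : ℂ) * ω')) ^ 2
        - 1 / (2 * (p.1.1 : ℂ) * ω + 2 * (p.1.2 : ℂ) * ω') ^ 2)

theorem tsum_ne_zero_eq_G {n : ℕ} (hn : n ≠ 0) :
    ∑' p : {p : ℤ × ℤ // p ≠ 0}, 1 / (2 * (p.1.1 : ℂ) * ω + 2 * (p.1.2 : ℂ) * ω') ^ n =
      (ofHalfPeriods ω ω' h).G n := by
  rw [G, ← (ofHalfPeriods ω ω' h).latticeEquivProd.symm.toEquiv.tsum_eq]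
  simp only [LinearEquiv.coe_toEquiv, ofHalfPeriods_latticeEquivProd_symm]
  refine (tsum_subtype_eq_of_support_subset (s := {p : ℤ × ℤ | p ≠ 0})
    (f := fun p : ℤ × ℤ ↦ 1 / (2 * (p.1 : ℂ) * ω + 2 * (p.2 : ℂ) * ω') ^ n) ?_).trans (by simp)
  rintro p hp rfl
  simp [hn] at hp

theorem g2inv_eq_g₂ : g2inv ω ω' = (ofHalfPeriods ω ω' h).g₂ := by
  rw [g2inv, tsum_ne_zero_eq_G h (by norm_num), g₂]

theorem g3inv_eq_g₃ : g3inv ω ω' = (ofHalfPeriods ω ω' h).g₃ := by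
  rw [g3inv, tsum_ne_zero_eq_G h (by norm_num), g₃]

theorem linearIndependent_two_mul_of_real_of_imaginary {ω ω' c : ℂ} (hc : c ≠ 0) (hω : ω.im = 0)
    (hωpos : 0 < ω.re) (hω' : ω'.re = 0) (hω'pos : 0 < ω'.im) :
    LinearIndependent ℝ ![2 * (c * ω), 2 * (c * ω')] := by
  rw [LinearIndependent.pair_iff]
  intro s t hst
  have h1 : (s : ℂ) * ω + t * ω' = 0 := by
    apply mul_left_cancel₀ (mul_ne_zero two_ne_zero hc)
    simp only [Complex.real_smul] at hst
    linear_combination hst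
  have hre := congrArg Complex.re h1
  have him := congrArg Complex.im h1
  simp [hω, hω'] at hre him
  exact ⟨hre.resolve_right hωpos.ne', him.resolve_right hω'pos.ne'⟩

end PeriodPair

theorem wp_mul_mul_mul (c ω ω' z : ℂ) : wp (c * ω) (c * ω') (c * z) = (c ^ 2)⁻¹ * wp ω ω' z := by
  rw [wp, wp, mul_add, ← tsum_mul_left]
  congr 1
  · simp [mul_pow, mul_comm]
  · refine tsum_congr fun p ↦ ?_
    rw [show c * z - (2 * (p.1.1 : ℂ) * (c * ω) + 2 * (p.1.2 : ℂ) * (c * ω')) =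
        c * (z - (2 * (p.1.1 : ℂ) * ω + 2 * (p.1.2 : ℂ) * ω')) by ring,
      show 2 * (p.1.1 : ℂ) * (c * ω) + 2 * (p.1.2 : ℂ) * (c * ω') =
        c * (2 * (p.1.1 : ℂ) * ω + 2 * (p.1.2 : ℂ) * ω') by ring]
    simp only [one_div, mul_pow, mul_inv]
    ring

theorem tsum_mul_mul (c ω ω' : ℂ) (n : ℕ) :
    ∑' p : {p : ℤ × ℤ // p ≠ 0},
      1 / (2 * (p.1.1 : ℂ) * (c * ω) + 2 * (p.1.2 : ℂ) * (c * ω')) ^ n =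
    (c ^ n)⁻¹ * ∑' p : {p : ℤ × ℤ // p ≠ 0},
      1 / (2 * (p.1.1 : ℂ) * ω + 2 * (p.1.2 : ℂ) * ω') ^ n := by
  rw [← tsum_mul_left]
  refine tsum_congr fun p ↦ ?_
  rw [show 2 * (p.1.1 : ℂ) * (c * ω) + 2 * (p.1.2 : ℂ) * (c * ω') =
    c * (2 * (p.1.1 : ℂ) * ω + 2 * (p.1.2 : ℂ) * ω') by ring]
  simp only [one_div, mul_pow, mul_inv]

theorem g2inv_mul_mul (c ω ω' : ℂ) : g2inv (c * ω) (c * ω') = (c ^ 4)⁻¹ * g2inv ω ω' := by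
  rw [g2inv, g2inv, tsum_mul_mul]
  ring

theorem g3inv_mul_mul (c ω ω' : ℂ) : g3inv (c * ω) (c * ω') = (c ^ 6)⁻¹ * g3inv ω ω' := by
  rw [g3inv, g3inv, tsum_mul_mul]
  ring


/-- Signature four: given the invariants of p_κ and p_λ (λ the complementary modulus),
the positivity normalisation of the half-periods, and p_κ(ω_κ′) = −1/3, the quadratic
modular transformation gives ℘(z; ω_κ, ω_κ′/2) = −2·p_λ(√2·i·z). -/
theorem stmt10 (κ lam : ℝ) (hκ : κ ∈ Set.Ioo (0:ℝ) 1) (hlam : lam = Real.sqrt (1 - κ^2))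
    (ωκ ωκ' ωl ωl' : ℂ)
    (hωκ : ωκ.im = 0) (hωκpos : 0 < ωκ.re) (hωκ' : ωκ'.re = 0) (hωκ'pos : 0 < ωκ'.im)
    (hωl : ωl.im = 0) (hωlpos : 0 < ωl.re) (hωl' : ωl'.re = 0) (hωl'pos : 0 < ωl'.im)
    (hg₂κ : g2inv ωκ ωκ' = 4/3 - (κ:ℂ)^2)
    (hg₃κ : g3inv ωκ ωκ' = 8/27 - (κ:ℂ)^2/3)
    (hg₂l : g2inv ωl ωl' = 4/3 - (lam:ℂ)^2)
    (hg₃l : g3inv ωl ωl' = 8/27 - (lam:ℂ)^2/3)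
    (hb : wp ωκ ωκ' ωκ' = -1/3) :
    ∀ z : ℂ, wp ωκ (ωκ' / 2) z = -2 * wp ωl ωl' ((Real.sqrt 2 : ℂ) * Complex.I * z) := by
  intro z
  have ind (ω ω' : ℂ) := PeriodPair.linearIndependent_two_mul_of_real_of_imaginary
    (ω := ω) (ω' := ω') one_ne_zero
  simp only [one_mul] at ind
  have hL := ind ωκ ωκ' hωκ hωκpos hωκ' hωκ'pos
  have hL' := ind ωκ (ωκ' / 2) hωκ hωκpos (by simp [hωκ']) (by simpa using hωκ'pos)
  obtain ⟨c, hc⟩ : ∃ c : ℂ, c * ((Real.sqrt 2 : ℂ) * Complex.I) = 1 :=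
    ⟨_, inv_mul_cancel₀ (by simp)⟩
  have hc0 : c ≠ 0 := left_ne_zero_of_mul_eq_one hc
  have hc2 : (c ^ 2)⁻¹ = -2 := by
    have hs : (Real.sqrt 2 : ℂ) ^ 2 = 2 := by exact_mod_cast Real.sq_sqrt (zero_le_two (α := ℝ))
    have h1 : c ^ 2 * (-2) = 1 := by
      linear_combination (c * ((Real.sqrt 2 : ℂ) * Complex.I) + 1) * hc - c ^ 2 * hs
        * Complex.I ^ 2 + (-2 * c ^ 2) * Complex.I_sq
    exact inv_eq_of_mul_eq_one_right h1
  have hM := PeriodPair.linearIndependent_two_mul_of_real_of_imaginary hc0 hωl hωlpos hωl' hωl'pos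
  have hw : ωκ' ∉ (PeriodPair.ofHalfPeriods ωκ ωκ' hL).lattice := by
    have := (PeriodPair.ofHalfPeriods ωκ ωκ' hL).ω₂_div_two_notMem_lattice
    simpa [PeriodPair.ofHalfPeriods] using this
  have hw₂ : 2 * ωκ' ∈ (PeriodPair.ofHalfPeriods ωκ ωκ' hL).lattice :=
    (PeriodPair.ofHalfPeriods ωκ ωκ' hL).ω₂_mem_lattice
  have hmem : ∀ x, x ∈ (PeriodPair.ofHalfPeriods ωκ (ωκ' / 2) hL').lattice ↔
      x ∈ (PeriodPair.ofHalfPeriods ωκ ωκ' hL).lattice ∨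
        x + ωκ' ∈ (PeriodPair.ofHalfPeriods ωκ ωκ' hL).lattice := by
    intro x
    simp only [PeriodPair.mem_lattice_ofHalfPeriods]
    constructor
    · rintro ⟨m, n, rfl⟩
      obtain ⟨k, rfl | rfl⟩ := Int.even_or_odd' n
      · refine .inl ⟨m, k, ?_⟩
        push_cast
        ring
      · refine .inr ⟨m, k + 1, ?_⟩
        push_cast
        ring
    · rintro (⟨m, n, hmn⟩ | ⟨m, n, hmn⟩)
      · refine ⟨m, 2 * n, ?_⟩
        rw [← hmn]
        push_cast
        ring
      · refine ⟨m, 2 * n - 1, ?_⟩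
        push_cast
        linear_combination hmn
  have hlam2 : (lam : ℂ) ^ 2 = 1 - (κ : ℂ) ^ 2 := by
    have : lam ^ 2 = 1 - κ ^ 2 := by
      rw [hlam, Real.sq_sqrt]
      nlinarith [hκ.1, hκ.2]
    exact_mod_cast this
  rw [PeriodPair.g2inv_eq_g₂ hL] at hg₂κ
  rw [PeriodPair.g3inv_eq_g₃ hL] at hg₃κ
  rw [PeriodPair.wp_eq_weierstrassP hL] at hb
  have hg₂ : (PeriodPair.ofHalfPeriods ωκ (ωκ' / 2) hL').g₂ =
      (PeriodPair.ofHalfPeriods (c * ωl) (c * ωl') hM).g₂ := by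
    rw [PeriodPair.g₂_eq_of_index_two hw hmem, ← PeriodPair.g2inv_eq_g₂ hM, g2inv_mul_mul,
      hg₂κ, hb, hg₂l, hlam2, show (c ^ 4)⁻¹ = ((c ^ 2)⁻¹) ^ 2 by ring, hc2]
    ring
  have hg₃ : (PeriodPair.ofHalfPeriods ωκ (ωκ' / 2) hL').g₃ =
      (PeriodPair.ofHalfPeriods (c * ωl) (c * ωl') hM).g₃ := by
    rw [PeriodPair.g₃_eq_of_index_two hw hw₂ hmem, ← PeriodPair.g3inv_eq_g₃ hM, g3inv_mul_mul,
      hg₃κ, hb, hg₃l, hlam2, show (c ^ 6)⁻¹ = ((c ^ 2)⁻¹) ^ 3 by ring, hc2]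
    ring
  rw [PeriodPair.wp_eq_weierstrassP hL', PeriodPair.weierstrassP_eq_of_g₂_eq_of_g₃_eq hg₂ hg₃,
    ← PeriodPair.wp_eq_weierstrassP hM, ← hc2, ← wp_mul_mul_mul, ← mul_assoc, hc, one_mul]
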